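/- arXiv:2406.08319 — 2 statements merged into one kernel-verified Lean document; each statement's English description precedes it below -/
import Mathlib

section
/- Let T be sub-n-normal on H and let S be the minimal n-normal extension of T. Then the approximate point spectrum of T is contained in the spectrum of S, which is contained in the spectrum of T; consequently ∂σ(T) ⊆ ∂σ(S). -/
open ContinuousLinearMap

section

variable {H K : Type*} [NormedAddCommGroup H] [InnerProductSpace ℂ H] [CompleteSpace H]
  [NormedAddCommGroup K] [InnerProductSpace ℂ K] [CompleteSpace K]

/-- `S ∈ B(K)` is an n-normal extension of `T ∈ B(H)` along the isometric embedding
`V : H → K` if `Sⁿ` is normal, `S` leaves (the image of) `H` invariant and `S|_H = T`. -/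
def IsNNormalExt (n : ℕ) (V : H →ₗᵢ[ℂ] K) (S : K →L[ℂ] K) (T : H →L[ℂ] H) : Prop :=
  IsStarNormal (S ^ n) ∧ ∀ x : H, S (V x) = V (T x)

/-- `S` is a *minimal* n-normal extension of `T` if no proper closed subspace of `K`
containing `H` and invariant under `S` yields, by restriction, an n-normal extension of `T`. -/
def IsMinimalNNormalExt (n : ℕ) (V : H →ₗᵢ[ℂ] K) (S : K →L[ℂ] K) (T : H →L[ℂ] H) : Prop :=
  IsNNormalExt n V S T ∧
  ∀ (M : Submodule ℂ K) (hM : IsClosed (M : Set K)) (hinv : ∀ y ∈ M, S y ∈ M)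
    (_ : ∀ x : H, V x ∈ M),
    (letI : CompleteSpace M := hM.completeSpace_coe
     IsStarNormal ((ContinuousLinearMap.codRestrict (S.comp M.subtypeL) M
        (fun y => hinv y y.2)) ^ n)) →
    M = ⊤

/-- The approximate point spectrum. -/
def approxPointSpectrum {E : Type*} [NormedAddCommGroup E] [NormedSpace ℂ E]
    (T : E →L[ℂ] E) : Set ℂ :=
  {lam : ℂ | ∃ g : ℕ → E, (∀ m, ‖g m‖ = 1) ∧
    Filter.Tendsto (fun m => ‖T (g m) - lam • g m‖) Filter.atTop (nhds 0)}


theorem min_kill (n : ℕ) (T : H →L[ℂ] H) (V : H →ₗᵢ[ℂ] K) (S : K →L[ℂ] K)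
    (hmin : IsMinimalNNormalExt n V S T) (X : K →L[ℂ] K) (hX : Commute S X)
    (hXV : ∀ x, X (V x) = 0) : X = 0 := by
  obtain ⟨⟨hN, hSV⟩, hm⟩ := hmin
  have hNX : Commute (star (S ^ n)) X := hN.commute_star_left (hX.pow_left n)
  have hcl : IsClosed ((LinearMap.ker (X : K →ₗ[ℂ] K) : Submodule ℂ K) : Set K) := X.isClosed_ker
  have app : ∀ A : K →L[ℂ] K, Commute A X → ∀ y, X (A y) = A (X y) := fun A hA y =>
    (DFunLike.congr_fun hA.eq y).symm
  have hinvA : ∀ A : K →L[ℂ] K, Commute A X →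
      ∀ y ∈ LinearMap.ker (X : K →ₗ[ℂ] K), A y ∈ LinearMap.ker (X : K →ₗ[ℂ] K) := by
    intro A hA y hy
    have hy' : X y = 0 := hy
    change X (A y) = 0
    rw [app A hA, hy', map_zero]
  have hinv := hinvA S hX
  have htop := hm (LinearMap.ker (X : K →ₗ[ℂ] K)) hcl hinv (fun x => hXV x) ?_
  · ext y
    have : y ∈ LinearMap.ker (X : K →ₗ[ℂ] K) := by rw [htop]; trivial
    exact this
  · letI : CompleteSpace (LinearMap.ker (X : K →ₗ[ℂ] K)) := hcl.completeSpace_coe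
    set M := LinearMap.ker (X : K →ₗ[ℂ] K) with hM
    set Sm := ContinuousLinearMap.codRestrict (S.comp M.subtypeL) M (fun y => hinv y y.2) with hSm
    have hpow : ∀ (k : ℕ) (y : M), (((Sm ^ k) y : M) : K) = (S ^ k) (y : K) := by
      intro k
      induction k with
      | zero => intro y; simp
      | succ k ih =>
        intro y
        rw [pow_succ, pow_succ, ContinuousLinearMap.mul_apply, ContinuousLinearMap.mul_apply, ih]
        rfl
    let B : M →L[ℂ] M := ContinuousLinearMap.codRestrict ((star (S ^ n)).comp M.subtypeL) M
      (fun y => hinvA _ hNX y y.2)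
    have hB : B = star (Sm ^ n) := by
      rw [ContinuousLinearMap.star_eq_adjoint, ContinuousLinearMap.eq_adjoint_iff]
      intro x y
      rw [Submodule.coe_inner, Submodule.coe_inner, hpow]
      change inner ℂ ((star (S ^ n)) (x : K)) (y : K) = _
      rw [ContinuousLinearMap.star_eq_adjoint, ContinuousLinearMap.adjoint_inner_left]
    refine ⟨?_⟩
    rw [← hB]
    ext y
    change (star (S ^ n)) (((Sm ^ n) y : M) : K) = (((Sm ^ n) (B y) : M) : K)
    rw [hpow, hpow]
    exact DFunLike.congr_fun hN.star_comm_self.eq (y : K)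

theorem key_kill (V : H →ₗᵢ[ℂ] K) (W D X : K →L[ℂ] K) (WT Z : H →L[ℂ] H)
    (hWV : ∀ x, W (V x) = V (WT x)) (hZ : WT * Z = 1) (hXW : X * W = D * X)
    (hlt : ‖D‖ * ‖Z‖ < 1) : ∀ x, X (V x) = 0 := by
  set Y : H →L[ℂ] K := X.comp V.toContinuousLinearMap with hY
  have h1 : Y = D.comp (Y.comp Z) := by
    ext x
    change X (V x) = D (X (V (Z x)))
    have e1 : V x = W (V (Z x)) := by
      rw [hWV]
      congr 1
      exact (DFunLike.congr_fun hZ x).symm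
    rw [e1]
    exact DFunLike.congr_fun hXW _
  have h2 : ‖Y‖ ≤ ‖D‖ * (‖Y‖ * ‖Z‖) := by
    calc ‖Y‖ = ‖D.comp (Y.comp Z)‖ := by rw [← h1]
      _ ≤ ‖D‖ * ‖Y.comp Z‖ := ContinuousLinearMap.opNorm_comp_le _ _
      _ ≤ _ := by gcongr; exact ContinuousLinearMap.opNorm_comp_le _ _
  have h3 : ‖Y‖ = 0 := by
    by_contra h
    have hp : 0 < ‖Y‖ := lt_of_le_of_ne (norm_nonneg _) (Ne.symm h)
    nlinarith
  have h4 : Y = 0 := norm_eq_zero.mp h3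
  intro x
  exact DFunLike.congr_fun h4 x

/-- scalar bump functions -/
theorem scalar_bump (μ : ℂ) (ε : ℝ) (hε : 0 < ε) : ∃ φ h c : ℂ → ℂ,
    Continuous φ ∧ Continuous h ∧ Continuous c ∧ (∀ z, φ z + (z - μ) * h z = 1) ∧
    (∀ z, ‖c z - μ‖ ≤ ε) ∧ (∀ z, φ z ≠ 0 → c z = z) := by
  have hpos : ∀ z : ℂ, 0 < max ‖z - μ‖ ε := fun z => lt_max_of_lt_right hε
  have hne : ∀ z : ℂ, ((max ‖z - μ‖ ε : ℝ) : ℂ) ≠ 0 := fun z => by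
    exact_mod_cast (hpos z).ne'
  have hcm : Continuous fun z : ℂ => ((max ‖z - μ‖ ε : ℝ) : ℂ) :=
    Complex.continuous_ofReal.comp (by fun_prop)
  let h : ℂ → ℂ := fun z => (starRingEnd ℂ) (z - μ) / ((max ‖z - μ‖ ε : ℝ) : ℂ) ^ 2
  have hh : Continuous h := by
    refine Continuous.div ?_ (hcm.pow 2) (fun z => pow_ne_zero _ (hne z))
    exact Complex.continuous_conj.comp (by fun_prop)
  refine ⟨fun z => 1 - (z - μ) * h z, h,
    fun z => μ + (z - μ) * ((ε : ℂ) / ((max ‖z - μ‖ ε : ℝ) : ℂ)), by fun_prop, hh, ?_, ?_, ?_, ?_⟩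
  · have : Continuous fun z : ℂ => (ε : ℂ) / ((max ‖z - μ‖ ε : ℝ) : ℂ) :=
      continuous_const.div hcm hne
    fun_prop
  · intro z; ring
  · intro z
    rw [add_sub_cancel_left, norm_mul, norm_div, Complex.norm_real, Complex.norm_real,
      Real.norm_of_nonneg hε.le, Real.norm_of_nonneg (hpos z).le, ← mul_div_assoc,
      div_le_iff₀ (hpos z), mul_comm]
    gcongr
    exact le_max_left _ _
  · intro z hz
    by_cases hzε : ‖z - μ‖ ≤ ε
    · have : (ε : ℂ) ≠ 0 := by exact_mod_cast hε.ne'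
      simp only [max_eq_right hzε, div_self this]
      ring
    · exfalso
      apply hz
      have hle : ε ≤ ‖z - μ‖ := (not_le.mp hzε).le
      have h0 : ((‖z - μ‖ : ℝ) : ℂ) ≠ 0 := by
        exact_mod_cast (hε.trans_le hle).ne'
      simp only [h, max_eq_left hle]
      rw [← mul_div_assoc, Complex.mul_conj']
      rw [div_self (pow_ne_zero _ h0), sub_self]

/-- local continuous root -/
theorem scalar_root (n : ℕ) (hn : n ≠ 0) (l : ℂ) (hl : l ≠ 0) (δ : ℝ) (hδ : 0 < δ) :
    ∃ ε > 0, ∃ ρ : ℂ → ℂ, ContinuousOn ρ (Metric.closedBall (l ^ n) ε) ∧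
      ∀ z ∈ Metric.closedBall (l ^ n) ε, ‖ρ z - l‖ ≤ δ ∧ ρ z ^ n = z := by
  let ρ : ℂ → ℂ := fun z => l * (z / l ^ n) ^ ((n : ℂ)⁻¹)
  have hln : l ^ n ≠ 0 := pow_ne_zero _ hl
  have hslit : IsOpen {z : ℂ | z / l ^ n ∈ Complex.slitPlane} :=
    Complex.isOpen_slitPlane.preimage (by fun_prop)
  have hmem : l ^ n ∈ {z : ℂ | z / l ^ n ∈ Complex.slitPlane} := by
    simp [div_self hln]
  have hc : ContinuousOn ρ {z : ℂ | z / l ^ n ∈ Complex.slitPlane} := by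
    apply ContinuousOn.mul continuousOn_const
    apply ContinuousOn.cpow (by fun_prop) continuousOn_const
    intro z hz; exact hz
  have hval : ρ (l ^ n) = l := by simp [ρ, div_self hln]
  have hca : ContinuousAt ρ (l ^ n) := hc.continuousAt (hslit.mem_nhds hmem)
  have h1 : ∀ᶠ z in nhds (l ^ n), ‖ρ z - l‖ ≤ δ := by
    have := hca (Metric.closedBall_mem_nhds _ hδ)
    rw [hval] at this
    filter_upwards [this] with z hz
    simpa [dist_eq_norm] using hz
  obtain ⟨ε, hε, hb⟩ := Metric.nhds_basis_closedBall.eventually_iff.mp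
    (h1.and (hslit.mem_nhds hmem))
  refine ⟨ε, hε, ρ, hc.mono (fun z hz => (hb hz).2), fun z hz => ⟨(hb hz).1, ?_⟩⟩
  simp only [ρ]
  rw [mul_pow, Complex.cpow_nat_inv_pow _ hn]
  field_simp

theorem unit_near (n : ℕ) (hn : n ≠ 0) (l : ℂ) (hl : l ≠ 0) :
    ∃ δ > 0, ∀ R : K →L[ℂ] K, ‖R - algebraMap ℂ (K →L[ℂ] K) l‖ ≤ δ →
      IsUnit (∑ i ∈ Finset.range n, (algebraMap ℂ (K →L[ℂ] K) l) ^ i * R ^ (n - 1 - i)) := by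
  let q : (K →L[ℂ] K) → (K →L[ℂ] K) := fun R =>
    ∑ i ∈ Finset.range n, (algebraMap ℂ (K →L[ℂ] K) l) ^ i * R ^ (n - 1 - i)
  have hq : Continuous q := by fun_prop
  have hv : q (algebraMap ℂ (K →L[ℂ] K) l) = algebraMap ℂ (K →L[ℂ] K) (n * l ^ (n - 1)) := by
    have : ∀ i ∈ Finset.range n, (algebraMap ℂ (K →L[ℂ] K) l) ^ i *
        (algebraMap ℂ (K →L[ℂ] K) l) ^ (n - 1 - i) = algebraMap ℂ (K →L[ℂ] K) (l ^ (n - 1)) := by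
      intro i hi
      rw [← pow_add, ← map_pow]
      congr 2
      have := Finset.mem_range.mp hi
      omega
    simp only [q]
    rw [Finset.sum_congr rfl this]
    simp
  have hu : IsUnit (q (algebraMap ℂ (K →L[ℂ] K) l)) := by
    rw [hv]
    apply IsUnit.map
    rw [isUnit_iff_ne_zero]
    exact mul_ne_zero (by exact_mod_cast hn) (pow_ne_zero _ hl)
  have := hq.continuousAt (x := algebraMap ℂ (K →L[ℂ] K) l) (Units.isOpen.mem_nhds hu)
  obtain ⟨δ, hδ, hb⟩ := Metric.nhds_basis_closedBall.mem_iff.mp this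
  refine ⟨δ, hδ, fun R hR => hb ?_⟩
  simpa [dist_eq_norm] using hR

theorem pow_sub_factor {A : Type*} [Ring A] (s l : A) (h : Commute s l) (i : ℕ) :
    ∃ g, Commute s g ∧ s ^ i - l ^ i = (s - l) * g := by
  refine ⟨∑ j ∈ Finset.range i, s ^ j * l ^ (i - 1 - j), ?_, (h.mul_geom_sum₂ i).symm⟩
  exact Commute.sum_right _ _ _ fun j _ => ((Commute.refl s).pow_right j).mul_right (h.pow_right _)

theorem unit_of_factor {A : Type*} [Ring A] (a y u : A) (hu : IsUnit u) (hy : Commute a y)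
    (h : u = a * y) : IsUnit a := by
  rw [h] at hu
  exact (hy.isUnit_mul_iff.mp hu).1

theorem resolvent_zero (n : ℕ) (hn : n ≠ 0) (T : H →L[ℂ] H) (V : H →ₗᵢ[ℂ] K) (S : K →L[ℂ] K)
    (hmin : IsMinimalNNormalExt n V S T) (hT : IsUnit T) : IsUnit S := by
  obtain ⟨Z, hZ⟩ := (hT.pow n).exists_right_inv
  have hN : IsStarNormal (S ^ n) := hmin.1.1
  have hSN : Commute (S ^ n) S := (Commute.refl S).pow_left n
  have hSN' : Commute (star (S ^ n)) S := hN.commute_star_left hSN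
  obtain ⟨φ, h, c, hφ, hh, hc, hsum, hcb, hcφ⟩ := scalar_bump 0 (1 / (‖Z‖ + 1)) (by positivity)
  have hX : cfc φ (S ^ n) = 0 := by
    apply min_kill n T V S hmin _ (hSN.cfc hSN' φ).symm
    apply key_kill V (S ^ n) (cfc c (S ^ n)) _ (T ^ n) Z ?_ hZ
    · conv_lhs => rw [← cfc_id' ℂ (S ^ n)]
      rw [cfc_id' ℂ (S ^ n)]
      nth_rewrite 2 [← cfc_id' ℂ (S ^ n)]
      rw [← cfc_mul φ (fun x => x) (S ^ n) hφ.continuousOn continuousOn_id,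
        ← cfc_mul c φ (S ^ n) hc.continuousOn hφ.continuousOn]
      congr 1
      ext z
      by_cases hz : φ z = 0
      · simp [hz]
      · rw [hcφ z hz, mul_comm]
    · have : ‖cfc c (S ^ n)‖ ≤ 1 / (‖Z‖ + 1) :=
        norm_cfc_le (by positivity) fun z _ => by simpa using hcb z
      have h2 : 1 / (‖Z‖ + 1) * ‖Z‖ < 1 := by
        rw [one_div_mul_eq_div, div_lt_one (by positivity)]; linarith
      exact lt_of_le_of_lt (by gcongr) h2
    · intro x
      have : ∀ k : ℕ, ∀ x, (S ^ k) (V x) = V ((T ^ k) x) := by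
        intro k
        induction k with
        | zero => intro x; simp
        | succ k ih =>
          intro x
          rw [pow_succ, pow_succ, ContinuousLinearMap.mul_apply, ContinuousLinearMap.mul_apply,
            hmin.1.2, ih]
      exact this n x
  have h1 : (1 : K →L[ℂ] K) = S ^ n * cfc h (S ^ n) := by
    have e : cfc (fun z => φ z + z * h z) (S ^ n) = 1 := by
      rw [← cfc_const_one ℂ (S ^ n)]
      congr 1
      ext z
      simpa using hsum z
    rw [cfc_add (S ^ n) φ (fun z => z * h z) hφ.continuousOn (by fun_prop), hX, zero_add,
      cfc_mul (fun z => z) h (S ^ n) (by fun_prop) hh.continuousOn, cfc_id' ℂ (S ^ n)] at e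
    exact e.symm
  have h2 : IsUnit (S ^ n) := unit_of_factor _ _ 1 isUnit_one
    (((Commute.refl (S ^ n)).cfc hN.star_comm_self h).symm) h1
  exact (isUnit_pow_iff hn).mp h2

theorem resolvent_ne (n : ℕ) (hn : n ≠ 0) (T : H →L[ℂ] H) (V : H →ₗᵢ[ℂ] K) (S : K →L[ℂ] K)
    (hmin : IsMinimalNNormalExt n V S T) (l : ℂ) (hl : l ≠ 0)
    (hT : IsUnit (T - algebraMap ℂ _ l)) : IsUnit (S - algebraMap ℂ _ l) := by
  obtain ⟨Z, hZ⟩ := hT.exists_right_inv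
  have hN : IsStarNormal (S ^ n) := hmin.1.1
  have hSN : Commute (S ^ n) S := (Commute.refl S).pow_left n
  have hSN' : Commute (star (S ^ n)) S := hN.commute_star_left hSN
  have hcom : ∀ f : ℂ → ℂ, Commute S (cfc f (S ^ n)) := fun f => (hSN.cfc hSN' f).symm
  obtain ⟨δ, hδ, hU⟩ := unit_near (K := K) n hn l hl
  obtain ⟨ε, hε, ρ, hρ, hρ'⟩ := scalar_root n hn l hl (min δ (1 / (‖Z‖ + 1)))
    (lt_min hδ (by positivity))
  obtain ⟨φ, h, c, hφ, hh, hc, hsum, hcb, hcφ⟩ := scalar_bump (l ^ n) ε hε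
  have hcb' : ∀ z, c z ∈ Metric.closedBall (l ^ n) ε := fun z => by
    simpa [dist_eq_norm] using hcb z
  let r : ℂ → ℂ := fun z => ρ (c z)
  have hr : Continuous r := hρ.comp_continuous hc hcb'
  set L := algebraMap ℂ (K →L[ℂ] K) l with hL
  have hSL : Commute S L := (Algebra.commute_algebraMap_right l S)
  set R := cfc r (S ^ n) with hR
  set F := cfc φ (S ^ n) with hF
  set G := cfc h (S ^ n) with hG
  have hSR : Commute S R := hcom r
  have hSF : Commute S F := hcom φ
  have hSG : Commute S G := hcom h
  have hRF : Commute R F := cfc_commute_cfc r φ (S ^ n)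
  have hRL : ‖R - L‖ ≤ min δ (1 / (‖Z‖ + 1)) := by
    have : R - L = cfc (fun z => r z - l) (S ^ n) := by
      rw [cfc_sub r (fun _ => l) (S ^ n) hr.continuousOn continuousOn_const, cfc_const l (S ^ n)]
    rw [this]
    exact norm_cfc_le (le_min hδ.le (by positivity)) fun z _ => (hρ' _ (hcb' z)).1
  have hFN : F * S ^ n = F * R ^ n := by
    have e1 : F * S ^ n = cfc (fun z => φ z * z) (S ^ n) := by
      rw [cfc_mul φ (fun z => z) (S ^ n) hφ.continuousOn (by fun_prop), cfc_id' ℂ (S ^ n)]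
    have e2 : F * R ^ n = cfc (fun z => φ z * r z ^ n) (S ^ n) := by
      rw [cfc_mul φ (fun z => r z ^ n) (S ^ n) hφ.continuousOn (by fun_prop),
        cfc_pow r n (S ^ n) hr.continuousOn]
    rw [e1, e2]
    congr 1
    ext z
    by_cases hz : φ z = 0
    · simp [hz]
    · simp only [r]
      rw [(hρ' _ (hcb' z)).2, hcφ z hz]
  have hFG : F + (S ^ n - L ^ n) * G = 1 := by
    have e : cfc (fun z => φ z + (z - l ^ n) * h z) (S ^ n) = 1 := by
      rw [← cfc_const_one ℂ (S ^ n)]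
      congr 1
      ext z
      exact hsum z
    rw [cfc_add (S ^ n) φ (fun z => (z - l ^ n) * h z) hφ.continuousOn (by fun_prop),
      cfc_mul (fun z => z - l ^ n) h (S ^ n) (by fun_prop) hh.continuousOn,
      cfc_sub (fun z => z) (fun _ => l ^ n) (S ^ n) (by fun_prop) continuousOn_const,
      cfc_id' ℂ (S ^ n), cfc_const (l ^ n) (S ^ n), map_pow] at e
    exact e
  set B := ∑ i ∈ Finset.range n, S ^ i * R ^ (n - 1 - i) with hB
  set U := ∑ i ∈ Finset.range n, L ^ i * R ^ (n - 1 - i) with hUdef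
  have hUu : IsUnit U := hU R (hRL.trans (min_le_left _ _))
  have hSB : Commute S B := Commute.sum_right _ _ _ fun j _ =>
    ((Commute.refl S).pow_right j).mul_right (hSR.pow_right _)
  have hSU : Commute S U := Commute.sum_right _ _ _ fun j _ =>
    (hSL.pow_right j).mul_right (hSR.pow_right _)
  have hX : F * B = 0 := by
    apply min_kill n T V S hmin _ (hSF.mul_right hSB)
    apply key_kill V (S - L) (R - L) _ (T - algebraMap ℂ _ l) Z ?_ hZ
    · have e1 : F * B * S = R * (F * B) := by
        have : (S - R) * B = S ^ n - R ^ n := hSR.mul_geom_sum₂ n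
        have e2 : F * ((S - R) * B) = 0 := by rw [this, mul_sub, hFN, sub_self]
        rw [mul_assoc, ← hSB.eq, ← mul_assoc, ← mul_assoc, hRF.eq, ← sub_eq_zero, ← e2]
        noncomm_ring
      rw [mul_sub, sub_mul, e1, (Algebra.commute_algebraMap_right l (F * B)).eq]
    · have h2 : 1 / (‖Z‖ + 1) * ‖Z‖ < 1 := by
        rw [one_div_mul_eq_div, div_lt_one (by positivity)]; linarith
      exact lt_of_le_of_lt (by gcongr; exact hRL.trans (min_le_right _ _)) h2
    · intro x
      simp [hL, hmin.1.2, Algebra.algebraMap_eq_smul_one]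
  obtain ⟨A, hSA, hA⟩ := pow_sub_factor S L hSL n
  choose g hSg hg using pow_sub_factor S L hSL
  set Q := ∑ i ∈ Finset.range n, g i * R ^ (n - 1 - i) with hQ
  have hSQ : Commute S Q := Commute.sum_right _ _ _ fun j _ =>
    (hSg j).mul_right (hSR.pow_right _)
  have hBU : B - U = (S - L) * Q := by
    rw [hB, hUdef, hQ, Finset.mul_sum, ← Finset.sum_sub_distrib]
    refine Finset.sum_congr rfl fun i _ => ?_
    rw [← sub_mul, hg, mul_assoc]
  have hLF : ∀ x : K →L[ℂ] K, Commute L x := fun x => Algebra.commute_algebraMap_left l x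
  have hSLF : Commute (S - L) F := hSF.sub_left (hLF F)
  refine unit_of_factor (S - L) (A * G * U - F * Q) U hUu ?_ ?_
  · exact (((hSA.mul_right hSG).mul_right hSU).sub_right (hSF.mul_right hSQ)).sub_left (hLF _)
  · have e1 : U = F * U + (S ^ n - L ^ n) * G * U := by
      rw [← add_mul, hFG, one_mul]
    have e2 : F * U = - ((S - L) * (F * Q)) := by
      have : F * (B - U) = F * ((S - L) * Q) := by rw [hBU]
      rw [mul_sub, hX, zero_sub, ← mul_assoc, ← hSLF.eq, mul_assoc] at this
      rw [← this, neg_neg]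
    rw [e2, hA] at e1
    rw [mul_sub]
    refine e1.trans ?_
    noncomm_ring

theorem resolvent_n_zero (T : H →L[ℂ] H) (V : H →ₗᵢ[ℂ] K) (S : K →L[ℂ] K)
    (hmin : IsMinimalNNormalExt 0 V S T) (l : ℂ)
    (hT : IsUnit (T - algebraMap ℂ _ l)) : IsUnit (S - algebraMap ℂ _ l) := by
  have hsurj : Function.Surjective V := by
    have hcl : IsClosed ((LinearMap.range V.toLinearMap : Submodule ℂ K) : Set K) := by
      have := V.isometry.isClosedEmbedding.isClosed_range
      have e : ((LinearMap.range V.toLinearMap : Submodule ℂ K) : Set K) = Set.range V := by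
        ext y; rfl
      rw [e]
      exact this
    have := hmin.2 (LinearMap.range V.toLinearMap) hcl ?_ (fun x => ⟨x, rfl⟩) ?_
    · intro y
      have hy : y ∈ LinearMap.range V.toLinearMap := by rw [this]; trivial
      exact hy
    · rintro _ ⟨x, rfl⟩
      exact ⟨T x, (hmin.1.2 x).symm⟩
    · letI : CompleteSpace (LinearMap.range V.toLinearMap) := hcl.completeSpace_coe
      refine ⟨?_⟩
      rw [pow_zero]
      exact Commute.one_right _
  have happ : ∀ x, (S - algebraMap ℂ (K →L[ℂ] K) l) (V x) =
      V ((T - algebraMap ℂ (H →L[ℂ] H) l) x) := by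
    intro x
    simp [hmin.1.2, Algebra.algebraMap_eq_smul_one]
  rw [ContinuousLinearMap.isUnit_iff_bijective] at hT ⊢
  constructor
  · intro a b hab
    obtain ⟨a, rfl⟩ := hsurj a
    obtain ⟨b, rfl⟩ := hsurj b
    rw [happ, happ] at hab
    rw [hT.1 (V.injective hab)]
  · intro y
    obtain ⟨y, rfl⟩ := hsurj y
    obtain ⟨x, rfl⟩ := hT.2 y
    exact ⟨V x, happ x⟩

theorem notMem_spec {E : Type*} [NormedAddCommGroup E] [NormedSpace ℂ E] (T : E →L[ℂ] E) (l : ℂ) :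
    l ∉ spectrum ℂ T ↔ IsUnit (T - algebraMap ℂ _ l) := by
  rw [spectrum.notMem_iff, ← IsUnit.neg_iff, neg_sub]

theorem bdd_below_of_notMem {E : Type*} [NormedAddCommGroup E] [NormedSpace ℂ E]
    (T : E →L[ℂ] E) (l : ℂ) (hl : l ∉ approxPointSpectrum T) :
    ∃ c > 0, ∀ x, c * ‖x‖ ≤ ‖T x - l • x‖ := by
  by_contra! hcon
  apply hl
  have : ∀ m : ℕ, ∃ x : E, ‖x‖ = 1 ∧ ‖T x - l • x‖ < 1 / ((m : ℝ) + 1) := by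
    intro m
    obtain ⟨x, hx⟩ := hcon (1 / ((m : ℝ) + 1)) (by positivity)
    have hx0 : 0 < ‖x‖ := by
      rw [norm_pos_iff]
      rintro rfl
      simp at hx
    refine ⟨((‖x‖⁻¹ : ℝ) : ℂ) • x, ?_, ?_⟩
    · rw [norm_smul, Complex.norm_real, norm_inv, norm_norm, inv_mul_cancel₀ hx0.ne']
    · rw [map_smul, smul_comm l, ← smul_sub, norm_smul, Complex.norm_real, norm_inv, norm_norm,
        inv_mul_lt_iff₀ hx0, mul_comm]
      exact hx
  choose g hg1 hg2 using this
  refine ⟨g, hg1, ?_⟩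
  exact squeeze_zero (fun _ => norm_nonneg _) (fun m => (hg2 m).le)
    tendsto_one_div_add_atTop_nhds_zero_nat

theorem approx_sub {E : Type*} [NormedAddCommGroup E] [NormedSpace ℂ E] [CompleteSpace E]
    (T : E →L[ℂ] E) : frontier (spectrum ℂ T) ⊆ approxPointSpectrum T := by
  intro l hl
  by_contra hna
  obtain ⟨c, hc, hb⟩ := bdd_below_of_notMem T l hna
  have hlc : l ∈ closure (spectrum ℂ T)ᶜ := by
    rw [closure_compl]; exact hl.2
  obtain ⟨w, hw, hd⟩ := Metric.mem_closure_iff.mp hlc (c / 2) (by positivity)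
  have hls : l ∈ spectrum ℂ T := (spectrum.isClosed T).frontier_subset hl
  have hu : IsUnit (T - algebraMap ℂ _ w) := (notMem_spec T w).mp hw
  obtain ⟨u, hu⟩ := hu
  have hbw : ∀ x, c / 2 * ‖x‖ ≤ ‖(u : E →L[ℂ] E) x‖ := by
    intro x
    have e : (u : E →L[ℂ] E) x = (T x - l • x) + (l - w) • x := by
      rw [hu]
      simp [Algebra.algebraMap_eq_smul_one, sub_smul]
    have h1 : ‖T x - l • x‖ ≤ ‖(u : E →L[ℂ] E) x‖ + ‖(l - w) • x‖ := by
      rw [e]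
      have := norm_sub_le ((T x - l • x) + (l - w) • x) ((l - w) • x)
      rwa [add_sub_cancel_right] at this
    rw [norm_smul] at h1
    rw [dist_eq_norm] at hd
    nlinarith [hb x, norm_nonneg x]
  have hinv : ‖((u⁻¹ : (E →L[ℂ] E)ˣ) : E →L[ℂ] E)‖ ≤ 2 / c := by
    refine ContinuousLinearMap.opNorm_le_bound _ (by positivity) fun y => ?_
    have h1 := hbw (((u⁻¹ : (E →L[ℂ] E)ˣ) : E →L[ℂ] E) y)
    rw [← ContinuousLinearMap.mul_apply, Units.mul_inv] at h1
    rw [div_mul_eq_mul_div, le_div_iff₀ hc]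
    simp only [ContinuousLinearMap.one_apply] at h1
    linarith
  apply (notMem_spec T l).mpr ?_ hls
  have hsmall : ‖((u⁻¹ : (E →L[ℂ] E)ˣ) : E →L[ℂ] E) * algebraMap ℂ (E →L[ℂ] E) (l - w)‖ < 1 := by
    rw [Algebra.algebraMap_eq_smul_one, mul_smul_comm, mul_one, norm_smul]
    rw [dist_eq_norm] at hd
    calc ‖l - w‖ * _ ≤ ‖l - w‖ * (2 / c) := by gcongr
      _ < c / 2 * (2 / c) := by gcongr
      _ = 1 := by field_simp
  have h2 := isUnit_one_sub_of_norm_lt_one hsmall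
  have h3 : T - algebraMap ℂ _ l = (u : E →L[ℂ] E) *
      (1 - ((u⁻¹ : (E →L[ℂ] E)ˣ) : E →L[ℂ] E) * algebraMap ℂ (E →L[ℂ] E) (l - w)) := by
    rw [mul_sub, mul_one, ← mul_assoc, Units.mul_inv, one_mul, hu, map_sub]
    abel
  rw [h3]
  exact u.isUnit.mul h2

/-- If `T` is sub-n-normal and `S` is its minimal n-normal extension, then
`σ_a(T) ⊆ σ(S) ⊆ σ(T)`, and consequently `∂σ(T) ⊆ ∂σ(S)`. -/
theorem spectra_of_minimal_extension
    (n : ℕ) (T : H →L[ℂ] H) (V : H →ₗᵢ[ℂ] K) (S : K →L[ℂ] K)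
    (hmin : IsMinimalNNormalExt n V S T) :
    approxPointSpectrum T ⊆ spectrum ℂ S ∧ spectrum ℂ S ⊆ spectrum ℂ T ∧
      frontier (spectrum ℂ T) ⊆ frontier (spectrum ℂ S) := by
  have h1 : approxPointSpectrum T ⊆ spectrum ℂ S := by
    rintro l ⟨g, hg1, hg2⟩
    by_contra hl
    obtain ⟨Y, hY⟩ := ((notMem_spec S l).mp hl).exists_left_inv
    have hbound : ∀ m, 1 ≤ ‖Y‖ * ‖T (g m) - l • g m‖ := by
      intro m
      have e : V (g m) = Y (V (T (g m) - l • g m)) := by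
        have := DFunLike.congr_fun hY (V (g m))
        simp only [ContinuousLinearMap.mul_apply, ContinuousLinearMap.one_apply] at this
        rw [← this]
        simp [hmin.1.2, Algebra.algebraMap_eq_smul_one]
      calc (1 : ℝ) = ‖V (g m)‖ := by rw [V.norm_map, hg1]
        _ = ‖Y (V (T (g m) - l • g m))‖ := by rw [← e]
        _ ≤ ‖Y‖ * ‖V (T (g m) - l • g m)‖ := Y.le_opNorm _
        _ = _ := by rw [V.norm_map]
    have ht := hg2.const_mul ‖Y‖
    rw [mul_zero] at ht
    have := ge_of_tendsto' ht hbound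
    linarith
  have h2 : spectrum ℂ S ⊆ spectrum ℂ T := by
    intro l hl
    by_contra hT
    apply (notMem_spec S l).mpr ?_ hl
    have hT' := (notMem_spec T l).mp hT
    rcases Nat.eq_zero_or_pos n with rfl | hn
    · exact resolvent_n_zero T V S hmin l hT'
    · by_cases hl0 : l = 0
      · subst hl0
        rw [map_zero, sub_zero] at hT' ⊢
        exact resolvent_zero n hn.ne' T V S hmin hT'
      · exact resolvent_ne n hn.ne' T V S hmin l hl0 hT'
  refine ⟨h1, h2, fun l hl => ?_⟩
  have hlS : l ∈ spectrum ℂ S := h1 (approx_sub T hl)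
  exact ⟨subset_closure hlS, fun hi => hl.2 (interior_mono h2 hi)⟩

end
end

section
/- The unilateral weighted shift W_α with weight sequence (a, b, 1, 1, 1, …), where 0 < a < b < 1, satisfies: W_α² is unitarily equivalent to the direct sum of the weighted shifts with weight sequences (ab, 1, 1, …) and (b, 1, 1, …), both of which are subnormal; hence W_α is 2-subnormal, although W_α itself is not subnormal. -/
noncomputable section

/-- `T` is subnormal if it has a normal extension. -/
def Subnormal {H : Type*} [NormedAddCommGroup H] [InnerProductSpace ℂ H] [CompleteSpace H]
    (T : H →L[ℂ] H) : Prop :=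
  ∃ (K : Type) (_ : NormedAddCommGroup K) (_ : InnerProductSpace ℂ K) (_ : CompleteSpace K)
    (V : H →ₗᵢ[ℂ] K) (N : K →L[ℂ] K),
    IsStarNormal N ∧ ∀ x : H, N (V x) = V (T x)

/-- `ℓ²(ℕ)`. -/
abbrev l2 : Type := lp (fun _ : ℕ => ℂ) 2

/-- The standard basis vectors of `ℓ²(ℕ)`. -/
def e (j : ℕ) : l2 := lp.single 2 j 1


section Helpers

open ContinuousLinearMap

theorem lp_inner_single {ι : Type} [DecidableEq ι] (i j : ι) :
    inner ℂ (lp.single 2 i 1 : lp (fun _ : ι => ℂ) 2) (lp.single 2 j 1) =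
      if i = j then 1 else 0 := by
  rw [lp.inner_single_left, lp.single_apply]
  by_cases h : i = j
  · subst h; simp
  · simp [h]

theorem lp_orthonormal {ι : Type} [DecidableEq ι] :
    Orthonormal ℂ (fun i : ι => (lp.single 2 i 1 : lp (fun _ : ι => ℂ) 2)) := by
  rw [orthonormal_iff_ite]
  exact lp_inner_single

theorem exists_isometry {ι : Type} [DecidableEq ι] {K : Type} [NormedAddCommGroup K]
    [InnerProductSpace ℂ K] [CompleteSpace K] {v : ι → K} (hv : Orthonormal ℂ v) :
    ∃ V : lp (fun _ : ι => ℂ) 2 →ₗᵢ[ℂ] K, ∀ i, V (lp.single 2 i 1) = v i := by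
  refine ⟨hv.orthogonalFamily.linearIsometry, fun i => ?_⟩
  rw [OrthogonalFamily.linearIsometry_apply_single]
  simp

theorem exists_unitary {ι : Type} [DecidableEq ι] {K : Type} [NormedAddCommGroup K]
    [InnerProductSpace ℂ K] [CompleteSpace K] {v : ι → K} (hv : Orthonormal ℂ v)
    (h0 : ∀ x, (∀ i, inner ℂ (v i) x = 0) → x = 0) :
    ∃ V : lp (fun _ : ι => ℂ) 2 ≃ₗᵢ[ℂ] K, ∀ i, V (lp.single 2 i 1) = v i := by
  have hbot : (Submodule.span ℂ (Set.range v))ᗮ = ⊥ := by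
    rw [eq_bot_iff]
    intro x hx
    rw [Submodule.mem_bot]
    apply h0
    intro i
    exact (Submodule.mem_orthogonal _ _).1 hx _ (Submodule.subset_span ⟨i, rfl⟩)
  refine ⟨(HilbertBasis.mkOfOrthogonalEqBot hv hbot).repr.symm, fun i => ?_⟩
  rw [HilbertBasis.repr_symm_single, HilbertBasis.coe_mkOfOrthogonalEqBot]

theorem lp_clm_ext {ι : Type} [DecidableEq ι] {K : Type} [NormedAddCommGroup K]
    [InnerProductSpace ℂ K] {A B : lp (fun _ : ι => ℂ) 2 →L[ℂ] K}
    (h : ∀ i, A (lp.single 2 i 1) = B (lp.single 2 i 1)) : A = B := by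
  have : Fact (1 ≤ (2 : ENNReal)) := ⟨by norm_num⟩
  refine lp.ext_continuousLinearMap (by norm_num) fun i => ?_
  ext
  simpa using h i

theorem normal_conj {H K : Type} [NormedAddCommGroup H] [InnerProductSpace ℂ H]
    [CompleteSpace H] [NormedAddCommGroup K] [InnerProductSpace ℂ K] [CompleteSpace K]
    (J : H →ₗᵢ[ℂ] K) (S : H ≃ₗᵢ[ℂ] H) :
    IsStarNormal (J.toContinuousLinearMap ∘L (S : H →L[ℂ] H) ∘L
      adjoint J.toContinuousLinearMap) := by
  have hJ : ∀ x, adjoint J.toContinuousLinearMap (J x) = x := fun x =>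
    congr($(J.adjoint_comp_self) x)
  constructor
  ext x
  simp [star_eq_adjoint, adjoint_comp, hJ]

theorem exists_normal (k : ℤ) :
    ∃ N : lp (fun _ : ℤ ⊕ ℕ => ℂ) 2 →L[ℂ] lp (fun _ : ℤ ⊕ ℕ => ℂ) 2, IsStarNormal N ∧
      (∀ n : ℤ, N (lp.single 2 (Sum.inl n) 1) = lp.single 2 (Sum.inl (n + k)) 1) ∧
      (∀ n : ℕ, N (lp.single 2 (Sum.inr n) 1) = 0) := by
  obtain ⟨J, hJ⟩ := exists_isometry (lp_orthonormal.comp (Sum.inl : ℤ → ℤ ⊕ ℕ)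
    Sum.inl_injective)
  obtain ⟨S, hS⟩ := exists_unitary (ι := ℤ) (lp_orthonormal.comp (fun n : ℤ => n + k)
    (add_left_injective k)) (by
      intro x hx
      ext n
      have := hx (n - k)
      simpa [lp.inner_single_left] using this)
  refine ⟨_, normal_conj J S, fun n => ?_, fun n => ?_⟩
  · have h1 : adjoint J.toContinuousLinearMap (J (lp.single 2 n 1)) = lp.single 2 n 1 :=
      congr($(J.adjoint_comp_self) (lp.single 2 n 1))
    have h2 := hJ n
    simp only [Function.comp] at h2 hJ hS
    rw [h2] at h1
    simp [h1, hS, hJ]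
  · have h1 : adjoint J.toContinuousLinearMap (lp.single 2 (Sum.inr n) 1) = 0 := by
      ext m
      have : inner ℂ (lp.single 2 m 1 : lp (fun _ : ℤ => ℂ) 2)
          (adjoint J.toContinuousLinearMap (lp.single 2 (Sum.inr n) 1)) = 0 := by
        rw [adjoint_inner_right]
        simp only [LinearIsometry.coe_toContinuousLinearMap, hJ, Function.comp, lp_inner_single]
        simp
      simpa [lp.inner_single_left] using this
    simp [h1]

theorem exists_shift (k : ℕ) (c : ℕ → ℝ) (h0 : ∀ j, 0 ≤ c j) (h1 : ∀ j, c j ≤ 1)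
    (hk : ∀ j, c (j + k) = 1) :
    ∃ T : l2 →L[ℂ] l2, (∀ j, T (e j) = (c j : ℂ) • e (j + k)) ∧ Subnormal T := by
  obtain ⟨N, hN, hl, hr⟩ := exists_normal k
  let v : ℕ → lp (fun _ : ℤ ⊕ ℕ => ℂ) 2 := fun j =>
    (c j : ℂ) • lp.single 2 (Sum.inl (j : ℤ)) 1 +
      (Real.sqrt (1 - c j ^ 2) : ℂ) • lp.single 2 (Sum.inr j) 1
  have hv : Orthonormal ℂ v := by
    rw [orthonormal_iff_ite]
    intro i j
    simp only [v, inner_add_left, inner_add_right, inner_smul_left, inner_smul_right,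
      lp_inner_single]
    by_cases h : i = j
    · subst h
      have hs : Real.sqrt (1 - c i ^ 2) * Real.sqrt (1 - c i ^ 2) = 1 - c i ^ 2 :=
        Real.mul_self_sqrt (by nlinarith [h0 i, h1 i])
      simp
      norm_cast
      rw [hs]; ring
    · simp [h]
  obtain ⟨V, hV⟩ := exists_isometry hv
  have hNv : ∀ j, N (v j) = (c j : ℂ) • v (j + k) := by
    intro j
    have hz : Real.sqrt (1 - c (j + k) ^ 2) = 0 := by rw [hk]; simp
    simp only [v, map_add, map_smul, hl, hr, hz]
    rw [hk, Complex.ofReal_one, Complex.ofReal_zero, one_smul, zero_smul, add_zero, smul_zero,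
      add_zero, Nat.cast_add]
  have hVV : ∀ x, adjoint V.toContinuousLinearMap (V x) = x := fun x =>
    congr($(V.adjoint_comp_self) x)
  let T : l2 →L[ℂ] l2 := adjoint V.toContinuousLinearMap ∘L N ∘L V.toContinuousLinearMap
  have hT : ∀ j, T (e j) = (c j : ℂ) • e (j + k) := by
    intro j
    simp only [T, e, comp_apply, LinearIsometry.coe_toContinuousLinearMap, hV, hNv, map_smul]
    rw [← hV, hVV]
  refine ⟨T, hT, lp (fun _ : ℤ ⊕ ℕ => ℂ) 2, inferInstance, inferInstance, inferInstance, V, N,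
    hN, ?_⟩
  have : N ∘L V.toContinuousLinearMap = V.toContinuousLinearMap ∘L T := by
    apply lp_clm_ext
    intro j
    have := hT j
    simp only [e] at this
    simp only [comp_apply, LinearIsometry.coe_toContinuousLinearMap, hV, hNv, this, map_smul]
  intro x
  exact congr($this x)

theorem normal_key {K : Type} [NormedAddCommGroup K] [InnerProductSpace ℂ K] [CompleteSpace K]
    (N : K →L[ℂ] K) (hN : IsStarNormal N) {a b : ℝ} (ha : a ≠ 0)
    {v0 v1 v2 v3 v4 : K} (h0 : N v0 = (a : ℂ) • v1) (h1 : N v1 = (b : ℂ) • v2)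
    (h2 : N v2 = v3) (h3 : N v3 = v4) (n1 : ‖v1‖ = 1) (n2 : ‖v2‖ = 1) (n3 : ‖v3‖ = 1)
    (n4 : ‖v4‖ = 1) : b ^ 2 = 1 := by
  have hnorm := isStarNormal_iff_norm_eq_adjoint.mp hN
  have hcomm : ∀ x, adjoint N (N x) = N (adjoint N x) := fun x =>
    congr($(hN.star_comm_self.eq) x)
  -- `N* N v2 = v2`
  have hv2 : adjoint N (N v2) = v2 := by
    rw [← sub_eq_zero, ← norm_eq_zero, ← sq_eq_zero_iff, @norm_sub_sq ℂ, adjoint_inner_left,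
      inner_self_eq_norm_sq, ← hnorm, h2, h3, n2, n3, n4]
    norm_num
  have hker : ∀ y, N (N y) = 0 → N y = 0 := by
    intro y hy
    have h : adjoint N (N y) = 0 := by
      rw [← norm_eq_zero, ← hnorm, hy, norm_zero]
    rw [← inner_self_eq_zero (𝕜 := ℂ), ← adjoint_inner_left, h, inner_zero_left]
  have hac : (a : ℂ) ≠ 0 := by exact_mod_cast ha
  have e1 : N (N (adjoint N (N v0) - v0)) = 0 := by
    rw [map_sub, map_sub, ← hcomm (N v0), ← hcomm (N (N v0)), h0, map_smul, h1, map_smul,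
      map_smul, map_smul, map_smul, hv2, sub_self]
  have e2 := hker _ e1
  rw [map_sub, ← hcomm (N v0), h0, map_smul, map_smul, ← smul_sub, smul_eq_zero] at e2
  have e3 : adjoint N (N v1) = v1 := sub_eq_zero.1 (e2.resolve_left hac)
  have e4 : inner ℂ (N v1) (N v1) = inner ℂ v1 v1 := by
    rw [← adjoint_inner_left, e3]
  rw [inner_self_eq_norm_sq_to_K, inner_self_eq_norm_sq_to_K, h1, norm_smul, n1, n2] at e4
  have e5 : (‖(b : ℂ)‖ * 1) ^ 2 = (1 : ℝ) ^ 2 := by exact_mod_cast e4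
  rw [Complex.norm_real, mul_one, Real.norm_eq_abs, sq_abs, one_pow] at e5
  exact e5

/-- The splitting of the basis into even and odd parts. -/
def splitVec (n : ℕ) : WithLp 2 (l2 × l2) :=
  if n % 2 = 0 then WithLp.toLp 2 (e (n / 2), 0) else WithLp.toLp 2 (0, e (n / 2))

theorem inner_e (i j : ℕ) : inner ℂ (e i) (e j) = if i = j then (1 : ℂ) else 0 :=
  lp_inner_single i j

theorem split_orthonormal : Orthonormal ℂ splitVec := by
  rw [orthonormal_iff_ite]
  intro i j
  unfold splitVec
  split_ifs <;> simp [WithLp.prod_inner_apply, inner_e] <;> grind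

theorem eq_zero_of_inner_e (x : l2) (h : ∀ j, inner ℂ (e j) x = 0) : x = 0 := by
  ext n
  simpa [e, lp.inner_single_left] using h n

theorem exists_split : ∃ U : l2 ≃ₗᵢ[ℂ] WithLp 2 (l2 × l2), ∀ n, U (e n) = splitVec n := by
  refine exists_unitary split_orthonormal fun x hx => ?_
  have hx1 : x.fst = 0 := eq_zero_of_inner_e _ fun j => by
    have := hx (2 * j)
    simpa [splitVec, WithLp.prod_inner_apply] using this
  have hx2 : x.snd = 0 := eq_zero_of_inner_e _ fun j => by
    have := hx (2 * j + 1)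
    have h2 : (2 * j + 1) / 2 = j := by omega
    simpa [splitVec, WithLp.prod_inner_apply, h2, Nat.add_mod] using this
  apply (WithLp.equiv 2 (l2 × l2)).injective
  exact Prod.ext hx1 hx2

end Helpers

/-- The weighted shift `W_α` with weights `(a, b, 1, 1, …)`, `0 < a < b < 1`, satisfies:
`W_α²` is unitarily equivalent to the direct sum of the weighted shifts with weight
sequences `(ab, 1, 1, …)` and `(b, 1, 1, …)`, both of which are subnormal; hence `W_α` is
2-subnormal (`W_α²` is subnormal), although `W_α` itself is not subnormal. -/
theorem shift_two_subnormal_not_subnormal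
    (a b : ℝ) (ha : 0 < a) (hab : a < b) (hb : b < 1)
    (W : l2 →L[ℂ] l2)
    (hW : ∀ j : ℕ,
      W (e j) = ((if j = 0 then (a : ℂ) else if j = 1 then (b : ℂ) else 1)) • e (j + 1)) :
    (∃ (W₁ W₂ : l2 →L[ℂ] l2),
      (∀ j : ℕ, W₁ (e j) = ((if j = 0 then ((a * b : ℝ) : ℂ) else 1)) • e (j + 1)) ∧
      (∀ j : ℕ, W₂ (e j) = ((if j = 0 then ((b : ℝ) : ℂ) else 1)) • e (j + 1)) ∧
      Subnormal W₁ ∧ Subnormal W₂ ∧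
      ∃ U : l2 ≃ₗᵢ[ℂ] WithLp 2 (l2 × l2),
        ∀ v : l2, U ((W ^ 2) v) =
          (WithLp.equiv 2 (l2 × l2)).symm
            (W₁ ((WithLp.equiv 2 (l2 × l2)) (U v)).1,
             W₂ ((WithLp.equiv 2 (l2 × l2)) (U v)).2)) ∧
    Subnormal (W ^ 2) ∧ ¬ Subnormal W := by
  have hb0 : 0 < b := ha.trans hab
  have hab1 : a * b ≤ 1 := by nlinarith
  obtain ⟨W₁, hW₁, hs₁⟩ := exists_shift 1 (fun j => if j = 0 then a * b else 1)
    (fun j => by split_ifs <;> positivity)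
    (fun j => by split_ifs <;> linarith) (fun j => by simp)
  obtain ⟨W₂, hW₂, hs₂⟩ := exists_shift 1 (fun j => if j = 0 then b else 1)
    (fun j => by split_ifs <;> positivity)
    (fun j => by split_ifs <;> linarith) (fun j => by simp)
  obtain ⟨T, hT, hsT⟩ := exists_shift 2
    (fun j => if j = 0 then a * b else if j = 1 then b else 1)
    (fun j => by split_ifs <;> positivity)
    (fun j => by split_ifs <;> linarith) (fun j => by simp)
  have hW2 : ∀ j, (W ^ 2) (e j) =
      ((if j = 0 then a * b else if j = 1 then b else 1 : ℝ) : ℂ) • e (j + 2) := by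
    intro j
    rw [pow_two, mul_apply_eq_comp, hW, map_smul, hW, smul_smul]
    rcases j with _ | _ | j <;> simp
  have hWT : W ^ 2 = T := lp_clm_ext fun j => by
    have h1 := hW2 j
    have h2 := hT j
    rw [← h2] at h1
    exact h1
  refine ⟨⟨W₁, W₂, ?_, ?_, hs₁, hs₂, ?_⟩, hWT ▸ hsT, ?_⟩
  · intro j
    rw [hW₁]
    split_ifs <;> simp
  · intro j
    rw [hW₂]
    split_ifs <;> simp
  · obtain ⟨U, hU⟩ := exists_split
    refine ⟨U, ?_⟩
    let P := WithLp.prodContinuousLinearEquiv 2 ℂ l2 l2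
    have key : (U : l2 →L[ℂ] WithLp 2 (l2 × l2)) ∘L (W ^ 2) =
        (P.symm : l2 × l2 →L[ℂ] WithLp 2 (l2 × l2)) ∘L (W₁.prodMap W₂) ∘L
          (P : WithLp 2 (l2 × l2) →L[ℂ] l2 × l2) ∘L (U : l2 →L[ℂ] WithLp 2 (l2 × l2)) := by
      apply lp_clm_ext
      intro j
      change U ((W ^ 2) (e j)) = P.symm (W₁.prodMap W₂ (P (U (e j))))
      rw [hW2, map_smul, hU, hU]
      apply P.injective
      rw [P.apply_symm_apply, map_smul]
      obtain ⟨m, rfl | rfl⟩ : ∃ m, j = 2 * m ∨ j = 2 * m + 1 := ⟨j / 2, by omega⟩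
      · have s1 : splitVec (2 * m) = WithLp.toLp 2 (e m, 0) := by simp [splitVec]
        have s2 : splitVec (2 * m + 2) = WithLp.toLp 2 (e (m + 1), 0) := by
          simp [splitVec]
        rw [s1, s2]
        change _ • ((e (m + 1), 0) : l2 × l2) = (W₁ (e m), W₂ 0)
        rw [hW₁]
        rcases m with _ | m <;> simp
      · have s1 : splitVec (2 * m + 1) = WithLp.toLp 2 (0, e m) := by
          have : (2 * m + 1) / 2 = m := by omega
          simp [splitVec, this, Nat.add_mod]
        have s2 : splitVec (2 * m + 1 + 2) = WithLp.toLp 2 (0, e (m + 1)) := by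
          have : (2 * m + 1 + 2) / 2 = m + 1 := by omega
          simp [splitVec, this, Nat.add_mod]
        rw [s1, s2]
        change _ • ((0, e (m + 1)) : l2 × l2) = (W₁ 0, W₂ (e m))
        rw [hW₂]
        rcases m with _ | m <;> simp
    intro v
    exact congr($key v)
  · rintro ⟨K, _, _, _, V, N, hN, hV⟩
    have hn : ∀ j, ‖V (e j)‖ = 1 := fun j => by
      rw [V.norm_map]; exact lp_orthonormal.1 j
    have := normal_key N hN (a := a) (b := b) (ne_of_gt ha) (v0 := V (e 0)) (v1 := V (e 1))
      (v2 := V (e 2)) (v3 := V (e 3)) (v4 := V (e 4)) (by rw [hV, hW, map_smul]; rfl)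
      (by rw [hV, hW, map_smul]; rfl) (by rw [hV, hW]; simp) (by rw [hV, hW]; simp)
      (hn 1) (hn 2) (hn 3) (hn 4)
    nlinarith
end
end
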